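/- One-step correlation formula with difference operators: for all square-summable f, g : Ẽ → ℝ, ⟨f, Q^Z g⟩_π̃ = Σ_{(D,n)∈Ẽ} π̃(D,n)·(λ/ξ^D_0)·Σ_{j∈J̃₀∖D} ξ^D_j f(D,n+e_j)·(Σ_{i∈J̃₀∖D} r^D_{ji} g(D,n+e_i)) + Σ_{n∈ℕ^{J̃}} π(n) Σ_{D⊆J̃} π̂(D) f(D,n)·(Q^Y g(·,n))(D) − Σ_{(D,n)∈Ẽ} π̃(D,n) f(D,n) g(D,n)·(λ + Σ_{j∈J̃∖D} μ_j(n_j)). -/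

import Mathlib

open scoped BigOperators

noncomputable section

namespace UnrelNet

/-- State space of the unreliable Jackson network: a set of broken-down nodes
together with a queue-length vector. -/
abbrev Est (J : ℕ) := Finset (Fin J) × (Fin J → ℕ)

/-- The extended node set `J̃₀ ∖ D`: the exterior node `none` together with
the up nodes (complement of `D`). -/
def ext (J : ℕ) (D : Finset (Fin J)) : Finset (Option (Fin J)) :=
  insert none (Dᶜ.image Option.some)

/-- Unit vector `e_j` of `ℕ^J̃`, with `e_0 = 0` (index `none`). -/
def eV {J : ℕ} (o : Option (Fin J)) : Fin J → ℕ := fun i =>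
  match o with
  | none => 0
  | some j => if i = j then 1 else 0

/-- Breakdown/repair generator `Q^Y`. -/
def QY {J : ℕ} (A B : Finset (Fin J) → ℝ) (f : Finset (Fin J) → ℝ)
    (D : Finset (Fin J)) : ℝ :=
  (∑ H ∈ Finset.univ.filter (fun H => H ⊂ D), B D / B H * (f H - f D))
    + ∑ I ∈ Finset.univ.filter (fun I => D ⊂ I), A I / A D * (f I - f D)

/-- Off-diagonal breakdown/repair rates. -/
def qY0 {J : ℕ} (A B : Finset (Fin J) → ℝ) (D E : Finset (Fin J)) : ℝ :=
  if D ⊂ E then A E / A D else if E ⊂ D then B D / B E else 0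

/-- Breakdown/repair rate matrix `q^Y`, including the diagonal. -/
def qY {J : ℕ} (A B : Finset (Fin J) → ℝ) (D E : Finset (Fin J)) : ℝ :=
  if E = D then -∑ F, qY0 A B D F else qY0 A B D E

/-- Breakdown/repair generator written via the rate matrix. -/
def QYm {J : ℕ} (A B : Finset (Fin J) → ℝ) (f : Finset (Fin J) → ℝ)
    (D : Finset (Fin J)) : ℝ :=
  ∑ E, qY A B D E * f E

/-- Normalisation constant `Ĉ`. -/
def Chat {J : ℕ} (A B : Finset (Fin J) → ℝ) : ℝ := ∑ D, A D / B D

/-- Stationary distribution `π̂` of the breakdown/repair process. -/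
def piY {J : ℕ} (A B : Finset (Fin J) → ℝ) (D : Finset (Fin J)) : ℝ :=
  (A D / B D) / Chat A B

/-- `Π_{i=1}^{k} η_j/μ_j(i)`. -/
def prodK {J : ℕ} (η : Fin J → ℝ) (μ : Fin J → ℕ → ℝ) (j : Fin J) (k : ℕ) : ℝ :=
  ∏ i ∈ Finset.range k, η j / μ j (i + 1)

/-- Normalisation constant `C_j`. -/
def Cnorm {J : ℕ} (η : Fin J → ℝ) (μ : Fin J → ℕ → ℝ) (j : Fin J) : ℝ :=
  ∑' k : ℕ, prodK η μ j k

/-- Product-form stationary distribution `π` of the Jackson network. -/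
def piX {J : ℕ} (η : Fin J → ℝ) (μ : Fin J → ℕ → ℝ) (n : Fin J → ℕ) : ℝ :=
  ∏ j, prodK η μ j (n j) / Cnorm η μ j

/-- Product measure `π̃(D,n) = π̂(D)·π(n)`. -/
def piZ {J : ℕ} (η : Fin J → ℝ) (μ : Fin J → ℕ → ℝ) (A B : Finset (Fin J) → ℝ)
    (x : Est J) : ℝ :=
  piY A B x.1 * piX η μ x.2

/-- Generator `Q^Z` of the unreliable Jackson network. -/
def QZ {J : ℕ} (lam : ℝ) (μ : Fin J → ℕ → ℝ)
    (r : Finset (Fin J) → Option (Fin J) → Option (Fin J) → ℝ)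
    (A B : Finset (Fin J) → ℝ) (f : Est J → ℝ) (x : Est J) : ℝ :=
  (∑ j ∈ x.1ᶜ, lam * r x.1 none (some j) * (f (x.1, x.2 + eV (some j)) - f x))
    + (∑ j ∈ x.1ᶜ, μ j (x.2 j) * r x.1 (some j) none * (f (x.1, x.2 - eV (some j)) - f x))
    + (∑ j ∈ x.1ᶜ, ∑ i ∈ x.1ᶜ,
        μ j (x.2 j) * r x.1 (some j) (some i) * (f (x.1, x.2 - eV (some j) + eV (some i)) - f x))
    + (∑ H ∈ Finset.univ.filter (fun H => H ⊂ x.1), B x.1 / B H * (f (H, x.2) - f x))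
    + ∑ I ∈ Finset.univ.filter (fun I => x.1 ⊂ I), A I / A x.1 * (f (I, x.2) - f x)

/-- Transition-rate matrix `q^Z` of the unreliable Jackson network
(between distinct states; the diagonal is set to `0`). -/
def qZ {J : ℕ} (lam : ℝ) (μ : Fin J → ℕ → ℝ)
    (r : Finset (Fin J) → Option (Fin J) → Option (Fin J) → ℝ)
    (A B : Finset (Fin J) → ℝ) (x y : Est J) : ℝ :=
  if x = y then 0
  else
    (if y.1 = x.1 then
        ∑ j ∈ x.1ᶜ,
          ((if y.2 = x.2 + eV (some j) then lam * r x.1 none (some j) else 0)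
            + (if y.2 + eV (some j) = x.2 then μ j (x.2 j) * r x.1 (some j) none else 0)
            + ∑ i ∈ x.1ᶜ,
                if i ≠ j ∧ y.2 + eV (some j) = x.2 + eV (some i) then
                  μ j (x.2 j) * r x.1 (some j) (some i)
                else 0)
      else 0)
    + (if y.2 = x.2 then
        (if y.1 ⊂ x.1 then B x.1 / B y.1 else 0) + (if x.1 ⊂ y.1 then A y.1 / A x.1 else 0)
      else 0)

/-- Extension `η^D` of the traffic solution: `η^D_0 = λ`, `η^D_j = η_j`. -/
def etaE {J : ℕ} (lam : ℝ) (η : Fin J → ℝ) : Option (Fin J) → ℝ := fun o => o.elim lam η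

/-- Normalised routing-equilibrium vector `ξ^D`. -/
def xiV {J : ℕ} (lam : ℝ) (η : Fin J → ℝ) (D : Finset (Fin J))
    (o : Option (Fin J)) : ℝ :=
  etaE lam η o / ∑ k ∈ ext J D, etaE lam η k

/-- Spectral gap of a generator on the network state space w.r.t. a measure `m`. -/
def GapZ {J : ℕ} (m : Est J → ℝ) (Q : (Est J → ℝ) → Est J → ℝ) : ℝ :=
  sInf {v : ℝ | ∃ f : Est J → ℝ,
    Summable (fun x => f x * f x * m x) ∧ (∑' x, f x * m x) = 0 ∧
      (∑' x, f x * f x * m x) = 1 ∧ v = ∑' x, f x * -(Q f x) * m x}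

/-- Spectral gap of a generator on `2^{J̃}` w.r.t. a probability vector `m`. -/
def GapY {J : ℕ} (m : Finset (Fin J) → ℝ)
    (Q : (Finset (Fin J) → ℝ) → Finset (Fin J) → ℝ) : ℝ :=
  sInf {v : ℝ | ∃ f : Finset (Fin J) → ℝ,
    (∑ D, m D * f D) = 0 ∧ (∑ D, m D * f D ^ 2) = 1 ∧
      v = -(∑ D, m D * f D * Q f D)}

/-- Merge a vector indexed by `D` with a vector indexed by `J̃∖D`. -/
def merge {J : ℕ} (D : Finset (Fin J)) (a : {j : Fin J // j ∈ D} → ℕ)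
    (b : {j : Fin J // j ∉ D} → ℕ) : Fin J → ℕ := fun j =>
  if h : j ∈ D then a ⟨j, h⟩ else b ⟨j, h⟩

/-- Marginal product-form density on a sub-collection of nodes. -/
def piSub {J : ℕ} (η : Fin J → ℝ) (μ : Fin J → ℕ → ℝ) (p : Fin J → Prop)
    [DecidablePred p] (a : {j : Fin J // p j} → ℕ) : ℝ :=
  ∏ j : {j : Fin J // p j}, prodK η μ j.1 (a j) / Cnorm η μ j.1

/-- Unit vector on a subtype index set. -/
def eS {J : ℕ} {p : Fin J → Prop} (j : {k : Fin J // p k}) :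
    {k : Fin J // p k} → ℕ := fun i => if i = j then 1 else 0

/-- Generator of the synthetic subnetwork on the up nodes `J̃∖D`. -/
def QXsub {J : ℕ} (lam : ℝ) (μ : Fin J → ℕ → ℝ)
    (r : Finset (Fin J) → Option (Fin J) → Option (Fin J) → ℝ)
    (D : Finset (Fin J)) (h : ({j : Fin J // j ∉ D} → ℕ) → ℝ)
    (m : {j : Fin J // j ∉ D} → ℕ) : ℝ :=
  (∑ j : {j : Fin J // j ∉ D}, lam * r D none (some j.1) * (h (m + eS j) - h m))
    + (∑ j : {j : Fin J // j ∉ D}, μ j.1 (m j) * r D (some j.1) none * (h (m - eS j) - h m))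
    + ∑ j : {j : Fin J // j ∉ D}, ∑ i : {j : Fin J // j ∉ D},
        μ j.1 (m j) * r D (some j.1) (some i.1) * (h (m - eS j + eS i) - h m)

/-- Transition-rate matrix `q^X` of the (reliable) Jackson network. -/
def qX {J : ℕ} (lam : ℝ) (μ : Fin J → ℕ → ℝ)
    (r : Option (Fin J) → Option (Fin J) → ℝ) (n m : Fin J → ℕ) : ℝ :=
  if n = m then 0
  else
    ∑ j : Fin J,
      ((if m = n + eV (some j) then lam * r none (some j) else 0)
        + (if m + eV (some j) = n then μ j (n j) * r (some j) none else 0)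
        + ∑ i : Fin J,
            if i ≠ j ∧ m + eV (some j) = n + eV (some i) then
              μ j (n j) * r (some j) (some i)
            else 0)

/-- One-step Markov operator `K = Id + ε·Q`. -/
def Kop {J : ℕ} (ε : ℝ) (Q : (Est J → ℝ) → Est J → ℝ) :
    (Est J → ℝ) → Est J → ℝ := fun h x => h x + ε * Q h x

lemma sum_ext {J : ℕ} (D : Finset (Fin J)) (F : Option (Fin J) → ℝ) :
    ∑ o ∈ ext J D, F o = F none + ∑ j ∈ Dᶜ, F (some j) := by
  unfold ext
  rw [Finset.sum_insert (by simp), Finset.sum_image (by intro a _ b _ h; simpa using h)]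

lemma eV_none {J : ℕ} : eV (none : Option (Fin J)) = 0 := by
  funext i; rfl

lemma summable_fin_prod {α β : Type*} [Finite α] (F : α × β → ℝ)
    (h : ∀ a, Summable fun b => F (a, b)) : Summable F := by
  have : Summable fun x => |F x| := by
    rw [summable_prod_of_nonneg (fun x => abs_nonneg _)]
    exact ⟨fun a => (h a).abs, Summable.of_finite⟩
  exact this.of_abs

lemma tsum_fin_prod {α β : Type*} [Fintype α] (F : α × β → ℝ)
    (h : ∀ a, Summable fun b => F (a, b)) : ∑' x, F x = ∑ a, ∑' b, F (a, b) := by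
  rw [(summable_fin_prod F h).tsum_prod, tsum_fintype]

lemma summable_mul_bdd {β : Type*} {s c : β → ℝ} {M : ℝ} (hs : Summable s)
    (hc0 : ∀ n, 0 ≤ c n) (hc : ∀ n, c n ≤ M) : Summable fun n => s n * c n := by
  refine Summable.of_norm_bounded (hs.abs.mul_right M) (fun n => ?_)
  rw [Real.norm_eq_abs, abs_mul, abs_of_nonneg (hc0 n)]
  exact mul_le_mul_of_nonneg_left (hc n) (abs_nonneg _)

lemma l2_mul {β : Type*} {w a b : β → ℝ} (hw : ∀ n, 0 ≤ w n)
    (ha : Summable fun n => a n * a n * w n) (hb : Summable fun n => b n * b n * w n) :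
    Summable fun n => w n * (a n * b n) := by
  refine Summable.of_norm_bounded (ha.add hb) (fun n => ?_)
  rw [Real.norm_eq_abs, abs_mul, abs_of_nonneg (hw n), ← add_mul, mul_comm]
  refine mul_le_mul_of_nonneg_right ?_ (hw n)
  rw [abs_le]
  constructor <;> nlinarith [sq_nonneg (a n + b n), sq_nonneg (a n - b n),
    mul_self_nonneg (a n), mul_self_nonneg (b n)]

section
variable {J : ℕ} {η : Fin J → ℝ} {μ : Fin J → ℕ → ℝ}

lemma prodK_pos (hη : ∀ j, 0 < η j) (hμpos : ∀ j k, k ≠ 0 → 0 < μ j k) (j : Fin J) (k : ℕ) :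
    0 < prodK η μ j k :=
  Finset.prod_pos fun i _ => div_pos (hη j) (hμpos j _ (Nat.succ_ne_zero i))

lemma Cnorm_pos (hη : ∀ j, 0 < η j) (hμpos : ∀ j k, k ≠ 0 → 0 < μ j k)
    (hC : ∀ j, Summable (fun k => prodK η μ j k)) (j : Fin J) : 0 < Cnorm η μ j :=
  (hC j).tsum_pos (fun k => (prodK_pos hη hμpos j k).le) 0 (prodK_pos hη hμpos j 0)

lemma piX_pos (hη : ∀ j, 0 < η j) (hμpos : ∀ j k, k ≠ 0 → 0 < μ j k)
    (hC : ∀ j, Summable (fun k => prodK η μ j k)) (n : Fin J → ℕ) : 0 < piX η μ n :=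
  Finset.prod_pos fun j _ => div_pos (prodK_pos hη hμpos j _) (Cnorm_pos hη hμpos hC j)

lemma eV_self (n : Fin J → ℕ) (j : Fin J) : (n + eV (some j)) j = n j + 1 := by
  simp [eV]

lemma piX_shift (hμpos : ∀ j k, k ≠ 0 → 0 < μ j k) (n : Fin J → ℕ) (j : Fin J) :
    piX η μ (n + eV (some j)) * μ j ((n + eV (some j)) j) = piX η μ n * η j := by
  unfold piX
  rw [← Finset.mul_prod_erase _ _ (Finset.mem_univ j),
    ← Finset.mul_prod_erase Finset.univ (fun i => prodK η μ i (n i) / Cnorm η μ i)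
      (Finset.mem_univ j)]
  have h : ∏ i ∈ Finset.univ.erase j, prodK η μ i ((n + eV (some j)) i) / Cnorm η μ i
      = ∏ i ∈ Finset.univ.erase j, prodK η μ i (n i) / Cnorm η μ i := by
    refine Finset.prod_congr rfl fun i hi => ?_
    have : (n + eV (some j)) i = n i := by simp [eV, Finset.ne_of_mem_erase hi]
    rw [this]
  rw [h, eV_self]
  have h2 : prodK η μ j (n j + 1) * μ j (n j + 1) = prodK η μ j (n j) * η j := by
    unfold prodK
    rw [Finset.prod_range_succ]
    have := (hμpos j (n j + 1) (Nat.succ_ne_zero _)).ne'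
    field_simp
  set P := ∏ i ∈ Finset.univ.erase j, prodK η μ i (n i) / Cnorm η μ i
  calc _ = (prodK η μ j (n j + 1) * μ j (n j + 1)) / Cnorm η μ j * P := by ring
    _ = _ := by rw [h2]; ring

lemma shift_inj (o : Option (Fin J)) : Function.Injective fun n : Fin J → ℕ => n + eV o :=
  fun a b h => add_right_cancel h

lemma l2_shift (hη : ∀ j, 0 < η j) (hμpos : ∀ j k, k ≠ 0 → 0 < μ j k)
    (hμ0 : ∀ j, μ j 0 = 0) (hμbdd : ∃ M : ℝ, ∀ j k, μ j k ≤ M)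
    (hC : ∀ j, Summable (fun k => prodK η μ j k)) (h : (Fin J → ℕ) → ℝ)
    (hh : Summable fun n => h n * h n * piX η μ n) (o : Option (Fin J)) :
    Summable fun n => h (n + eV o) * h (n + eV o) * piX η μ n := by
  cases o with
  | none => simpa [eV_none] using hh
  | some j =>
    obtain ⟨M, hM⟩ := hμbdd
    have hn : ∀ k, 0 ≤ μ j k := fun k => by
      rcases eq_or_ne k 0 with rfl | hk
      · rw [hμ0]
      · exact (hμpos j k hk).le
    have h1 : Summable fun n : Fin J → ℕ => (h n * h n * piX η μ n) * μ j (n j) :=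
      summable_mul_bdd hh (fun n => hn _) (fun n => hM j _)
    have h2 := (h1.comp_injective (shift_inj (some j))).mul_right (η j)⁻¹
    refine h2.congr fun n => ?_
    simp only [Function.comp]
    rw [mul_assoc (h _ * h _), piX_shift hμpos, mul_assoc, mul_assoc (piX η μ n),
      mul_inv_cancel₀ (hη j).ne', mul_one]

lemma shift_summable (hμpos : ∀ j k, k ≠ 0 → 0 < μ j k)
    (hμ0 : ∀ j, μ j 0 = 0) (G : (Fin J → ℕ) → ℝ) (j : Fin J) :
    ((Summable fun n => piX η μ n * (η j * G (n + eV (some j)))) ↔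
      Summable fun n => piX η μ n * (μ j (n j) * G n)) ∧
    (∑' n, piX η μ n * (η j * G (n + eV (some j))) = ∑' n, piX η μ n * (μ j (n j) * G n)) := by
  have e : (fun n => piX η μ n * (η j * G (n + eV (some j)))) =
      (fun n => piX η μ n * (μ j (n j) * G n)) ∘ (fun n => n + eV (some j)) := by
    funext n
    simp only [Function.comp]
    rw [← mul_assoc, ← piX_shift hμpos, mul_assoc]
  have hr : ∀ n ∉ Set.range (fun n : Fin J → ℕ => n + eV (some j)),
      piX η μ n * (μ j (n j) * G n) = 0 := by
    intro n hn
    have : n j = 0 := by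
      by_contra hne
      apply hn
      refine ⟨n - eV (some j), ?_⟩
      funext i
      by_cases hi : i = j
      · subst hi; simp [eV]; omega
      · simp [eV, hi]
    rw [this, hμ0]; ring
  constructor
  · rw [e]; exact (shift_inj (some j)).summable_iff hr
  · rw [e]
    refine (shift_inj (some j)).tsum_eq (f := fun n => piX η μ n * (μ j (n j) * G n)) ?_
    intro n hn
    by_contra hc
    exact hn (hr n hc)
end

/-- departure rate -/
def rt {J : ℕ} (lam : ℝ) (μ : Fin J → ℕ → ℝ) (n : Fin J → ℕ) (o : Option (Fin J)) : ℝ :=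
  o.elim lam (fun j => μ j (n j))

lemma QZ_eq {J : ℕ} (lam : ℝ) (μ : Fin J → ℕ → ℝ)
    (r : Finset (Fin J) → Option (Fin J) → Option (Fin J) → ℝ)
    (hrsto : ∀ D : Finset (Fin J), ∀ i ∈ ext J D, ∑ j ∈ ext J D, r D i j = 1)
    (A B : Finset (Fin J) → ℝ) (g : Est J → ℝ) (D : Finset (Fin J)) (n : Fin J → ℕ) :
    QZ lam μ r A B g (D, n) =
      ∑ o ∈ ext J D, rt lam μ n o * ∑ i ∈ ext J D, r D o i * g (D, n - eV o + eV i)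
      + QY A B (fun E => g (E, n)) D - g (D, n) * (lam + ∑ j ∈ Dᶜ, μ j (n j)) := by
  have h0 := hrsto D none (by simp [ext])
  rw [sum_ext] at h0
  have hj : ∀ j ∈ Dᶜ, r D (some j) none + ∑ i ∈ Dᶜ, r D (some j) (some i) = 1 := by
    intro j hj
    rw [← sum_ext D (fun o => r D (some j) o)]
    exact hrsto D (some j) (by simpa [ext] using hj)
  have e1 : ∑ j ∈ Dᶜ, lam * r D none (some j) * (g (D, n + eV (some j)) - g (D, n))
      = lam * (∑ i ∈ ext J D, r D none i * g (D, n - eV none + eV i)) - lam * g (D, n) := by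
    rw [sum_ext]
    simp only [eV_none, tsub_zero, add_zero, mul_sub, Finset.sum_sub_distrib, mul_add]
    simp only [mul_assoc, ← Finset.mul_sum, ← Finset.sum_mul]
    linear_combination (-lam * g (D, n)) * h0
  have e2 : (∑ j ∈ Dᶜ, μ j (n j) * r D (some j) none * (g (D, n - eV (some j)) - g (D, n)))
    + (∑ j ∈ Dᶜ, ∑ i ∈ Dᶜ,
        μ j (n j) * r D (some j) (some i) * (g (D, n - eV (some j) + eV (some i)) - g (D, n)))
      = (∑ j ∈ Dᶜ, μ j (n j) * ∑ i ∈ ext J D, r D (some j) i * g (D, n - eV (some j) + eV i))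
        - g (D, n) * ∑ j ∈ Dᶜ, μ j (n j) := by
    rw [← Finset.sum_add_distrib, Finset.mul_sum, ← Finset.sum_sub_distrib]
    refine Finset.sum_congr rfl fun j hj' => ?_
    rw [sum_ext]
    simp only [eV_none, add_zero, mul_sub, Finset.sum_sub_distrib, mul_add]
    simp only [mul_assoc, ← Finset.mul_sum, ← Finset.sum_mul]
    linear_combination (-μ j (n j) * g (D, n)) * hj j hj'
  rw [sum_ext]
  simp only [QZ, QY, rt, Option.elim]
  linear_combination e1 + e2

/-- one-step correlation formula with difference operators
(compact form of the one-step correlation). -/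
theorem one_step_correlation_compact
    (J : ℕ) (hJ : 1 ≤ J)
    (lam : ℝ) (hlam : 0 < lam)
    (μ : Fin J → ℕ → ℝ)
    (hμ0 : ∀ j, μ j 0 = 0)
    (hμpos : ∀ j k, k ≠ 0 → 0 < μ j k)
    (hμbdd : ∃ M : ℝ, ∀ j k, μ j k ≤ M)
    (r : Finset (Fin J) → Option (Fin J) → Option (Fin J) → ℝ)
    (hrnn : ∀ D : Finset (Fin J), ∀ i ∈ ext J D, ∀ j ∈ ext J D, 0 ≤ r D i j)
    (hrsto : ∀ D : Finset (Fin J), ∀ i ∈ ext J D, ∑ j ∈ ext J D, r D i j = 1)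
    (η : Fin J → ℝ) (hη : ∀ j, 0 < η j)
    (htraffic : ∀ D : Finset (Fin J), ∀ j ∈ Dᶜ,
      η j = lam * r D none (some j) + ∑ i ∈ Dᶜ, η i * r D (some i) (some j))
    (A B : Finset (Fin J) → ℝ)
    (hApos : ∀ D, 0 < A D) (hBpos : ∀ D, 0 < B D)
    (hA0 : A (∅ : Finset (Fin J)) = 1) (hB0 : B (∅ : Finset (Fin J)) = 1)
    (hC : ∀ j, Summable (fun k => prodK η μ j k))
    (f g : Est J → ℝ)
    (hf : Summable (fun x : Est J => f x * f x * piZ η μ A B x))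
    (hg : Summable (fun x : Est J => g x * g x * piZ η μ A B x)) :
    (∑' x : Est J, f x * QZ lam μ r A B g x * piZ η μ A B x)
      = (∑' x : Est J, piZ η μ A B x * (lam / xiV lam η x.1 none) *
          ∑ j ∈ ext J x.1, xiV lam η x.1 j * f (x.1, x.2 + eV j)
            * ∑ i ∈ ext J x.1, r x.1 j i * g (x.1, x.2 + eV i))
        + (∑' n : Fin J → ℕ, piX η μ n * ∑ D : Finset (Fin J),
            piY A B D * f (D, n) * QY A B (fun E => g (E, n)) D)
        - ∑' x : Est J, piZ η μ A B x * f x * g x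
            * (lam + ∑ j ∈ x.1ᶜ, μ j (x.2 j)) := by
  have hw : ∀ n, 0 ≤ piX η μ n := fun n => (piX_pos hη hμpos hC n).le
  have hAB : ∀ D, 0 < A D / B D := fun D => div_pos (hApos D) (hBpos D)
  have hCh : 0 < Chat A B := Finset.sum_pos (fun D _ => hAB D) Finset.univ_nonempty
  have hY : ∀ D, 0 < piY A B D := fun D => div_pos (hAB D) hCh
  have hL2 : ∀ h : Est J → ℝ, Summable (fun x : Est J => h x * h x * piZ η μ A B x) →
      ∀ D, Summable fun n => h (D, n) * h (D, n) * piX η μ n := by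
    intro h hh D
    have := (hh.comp_injective (Prod.mk_right_injective D)).mul_right (piY A B D)⁻¹
    refine this.congr fun n => ?_
    have := (hY D).ne'
    simp only [Function.comp, piZ]
    field_simp
  have hfD := hL2 f hf
  have hgD := hL2 g hg
  have sh : ∀ h : Est J → ℝ, (∀ D, Summable fun n => h (D, n) * h (D, n) * piX η μ n) → ∀ D o,
      Summable fun n => h (D, n + eV o) * h (D, n + eV o) * piX η μ n :=
    fun h hh D o => l2_shift hη hμpos hμ0 hμbdd hC (fun n => h (D, n)) (hh D) o
  -- shifted terms
  have sR0 : ∀ D o i, Summable fun n => piX η μ n * (f (D, n + eV o) * g (D, n + eV i)) :=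
    fun D o i => l2_mul hw (sh f hfD D o) (sh g hgD D i)
  have sR1 : ∀ D o, Summable fun n => piX η μ n * (etaE lam η o *
      (f (D, n + eV o) * ∑ i ∈ ext J D, r D o i * g (D, n + eV i))) := by
    intro D o
    have : Summable fun n => ∑ i ∈ ext J D, etaE lam η o * r D o i *
        (piX η μ n * (f (D, n + eV o) * g (D, n + eV i))) :=
      summable_sum fun i _ => (sR0 D o i).mul_left _
    refine this.congr fun n => ?_
    simp only [Finset.mul_sum]
    exact Finset.sum_congr rfl fun i _ => by ring
  have key : ∀ D o, (Summable fun n => piX η μ n * (rt lam μ n o *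
        (f (D, n) * ∑ i ∈ ext J D, r D o i * g (D, n - eV o + eV i)))) ∧
      ∑' n, piX η μ n * (etaE lam η o *
        (f (D, n + eV o) * ∑ i ∈ ext J D, r D o i * g (D, n + eV i))) =
      ∑' n, piX η μ n * (rt lam μ n o *
        (f (D, n) * ∑ i ∈ ext J D, r D o i * g (D, n - eV o + eV i))) := by
    intro D o
    cases o with
    | none =>
      have := sR1 D none
      simp only [eV_none, etaE, rt, Option.elim, tsub_zero, add_zero] at this ⊢
      exact ⟨this, trivial⟩
    | some j =>
      have h1 := sR1 D (some j)
      have h2 := shift_summable (η := η) hμpos hμ0 (fun n => f (D, n) *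
        ∑ i ∈ ext J D, r D (some j) i * g (D, n - eV (some j) + eV i)) j
      simp only [add_tsub_cancel_right] at h2
      exact ⟨h2.1.1 h1, h2.2⟩
  -- QY term
  have sQ : ∀ D, Summable fun n => piX η μ n * (f (D, n) * QY A B (fun E => g (E, n)) D) := by
    intro D
    have h0 : ∀ E, Summable fun n => piX η μ n * (f (D, n) * g (E, n)) :=
      fun E => l2_mul hw (hfD D) (hgD E)
    have : Summable fun n =>
        (∑ H ∈ Finset.univ.filter (fun H => H ⊂ D), B D / B H *
          (piX η μ n * (f (D, n) * g (H, n)) - piX η μ n * (f (D, n) * g (D, n))))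
        + ∑ I ∈ Finset.univ.filter (fun I => D ⊂ I), A I / A D *
          (piX η μ n * (f (D, n) * g (I, n)) - piX η μ n * (f (D, n) * g (D, n))) :=
      (summable_sum fun H _ => ((h0 H).sub (h0 D)).mul_left _).add
        (summable_sum fun H _ => ((h0 H).sub (h0 D)).mul_left _)
    refine this.congr fun n => ?_
    simp only [QY, mul_add, Finset.mul_sum]
    congr 1 <;> exact Finset.sum_congr rfl fun i _ => by ring
  have sT : ∀ D, Summable fun n => piX η μ n * (f (D, n) * g (D, n)
      * (lam + ∑ j ∈ Dᶜ, μ j (n j))) := by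
    intro D
    obtain ⟨M, hM⟩ := hμbdd
    have h0 : Summable fun n => piX η μ n * (f (D, n) * g (D, n)) := l2_mul hw (hfD D) (hgD D)
    have hn : ∀ j k, 0 ≤ μ j k := fun j k => by
      rcases eq_or_ne k 0 with rfl | hk
      · rw [hμ0]
      · exact (hμpos j k hk).le
    have := summable_mul_bdd (c := fun n : Fin J → ℕ => lam + ∑ j ∈ Dᶜ, μ j (n j))
      (M := lam + ∑ j ∈ Dᶜ, M) h0
      (fun n => add_nonneg hlam.le (Finset.sum_nonneg fun j _ => hn _ _))
      (fun n => add_le_add le_rfl (Finset.sum_le_sum fun j _ => hM _ _))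
    exact this.congr fun n => by ring
  have hxi : ∀ D o, lam / xiV lam η D none * xiV lam η D o = etaE lam η o := by
    intro D o
    have : 0 < ∑ k ∈ ext J D, etaE lam η k := by
      rw [sum_ext]
      exact add_pos_of_pos_of_nonneg hlam (Finset.sum_nonneg fun j _ => (hη j).le)
    have h2 := hlam.ne'
    have h3 := this.ne'
    simp only [xiV]
    generalize (∑ k ∈ ext J D, etaE lam η k) = S at h3
    have : etaE lam η none = lam := rfl
    rw [this]
    field_simp
  -- pointwise forms
  have pL : ∀ D n, f (D, n) * QZ lam μ r A B g (D, n) * piZ η μ A B (D, n) =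
      piY A B D * (∑ o ∈ ext J D, piX η μ n * (rt lam μ n o *
          (f (D, n) * ∑ i ∈ ext J D, r D o i * g (D, n - eV o + eV i)))
        + piX η μ n * (f (D, n) * QY A B (fun E => g (E, n)) D)
        - piX η μ n * (f (D, n) * g (D, n) * (lam + ∑ j ∈ Dᶜ, μ j (n j)))) := by
    intro D n
    rw [QZ_eq lam μ r hrsto]
    have : ∑ o ∈ ext J D, piX η μ n * (rt lam μ n o *
          (f (D, n) * ∑ i ∈ ext J D, r D o i * g (D, n - eV o + eV i))) =
        piX η μ n * f (D, n) * ∑ o ∈ ext J D, rt lam μ n o *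
          ∑ i ∈ ext J D, r D o i * g (D, n - eV o + eV i) := by
      rw [Finset.mul_sum]
      exact Finset.sum_congr rfl fun o _ => by ring
    rw [this]
    simp only [piZ]
    ring
  have pR : ∀ D n, piZ η μ A B (D, n) * (lam / xiV lam η D none) *
          ∑ j ∈ ext J D, xiV lam η D j * f (D, n + eV j)
            * ∑ i ∈ ext J D, r D j i * g (D, n + eV i) =
      piY A B D * ∑ o ∈ ext J D, piX η μ n * (etaE lam η o *
      (f (D, n + eV o) * ∑ i ∈ ext J D, r D o i * g (D, n + eV i))) := by
    intro D n
    rw [Finset.mul_sum, Finset.mul_sum]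
    refine Finset.sum_congr rfl fun o _ => ?_
    rw [← hxi D o]
    simp only [piZ]
    ring
  have pT : ∀ D n, piZ η μ A B (D, n) * f (D, n) * g (D, n) * (lam + ∑ j ∈ Dᶜ, μ j (n j)) =
      piY A B D * (piX η μ n * (f (D, n) * g (D, n) * (lam + ∑ j ∈ Dᶜ, μ j (n j)))) := by
    intro D n
    simp only [piZ]
    ring
  have pQ : ∀ n, piX η μ n * ∑ D : Finset (Fin J),
      piY A B D * f (D, n) * QY A B (fun E => g (E, n)) D =
      ∑ D : Finset (Fin J),
        piY A B D * (piX η μ n * (f (D, n) * QY A B (fun E => g (E, n)) D)) := by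
    intro n
    rw [Finset.mul_sum]
    exact Finset.sum_congr rfl fun D _ => by ring
  have sK : ∀ D, Summable fun n => ∑ o ∈ ext J D, piX η μ n * (rt lam μ n o *
        (f (D, n) * ∑ i ∈ ext J D, r D o i * g (D, n - eV o + eV i))) :=
    fun D => summable_sum fun o _ => (key D o).1
  have sR : ∀ D, Summable fun n => ∑ o ∈ ext J D, piX η μ n * (etaE lam η o *
      (f (D, n + eV o) * ∑ i ∈ ext J D, r D o i * g (D, n + eV i))) :=
    fun D => summable_sum fun o _ => sR1 D o
  rw [tsum_fin_prod _ (fun D => by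
      simp only [pL]; exact (((sK D).add (sQ D)).sub (sT D)).mul_left _),
    tsum_fin_prod _ (fun D => by simp only [pR]; exact (sR D).mul_left _),
    tsum_fin_prod _ (fun D => by simp only [pT]; exact (sT D).mul_left _)]
  simp only [pL, pR, pT, pQ]
  rw [Summable.tsum_finsetSum (fun D _ => (sQ D).mul_left _), ← Finset.sum_add_distrib,
    ← Finset.sum_sub_distrib]
  refine Finset.sum_congr rfl fun D _ => ?_
  simp only [tsum_mul_left]
  rw [((sK D).add (sQ D)).tsum_sub (sT D), (sK D).tsum_add (sQ D),
    Summable.tsum_finsetSum (fun o _ => (key D o).1), Summable.tsum_finsetSum (fun o _ => sR1 D o),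
    Finset.sum_congr rfl (fun o _ => (key D o).2)]
  ring

end UnrelNet
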